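/- Beurling–Helson theorem: let μ ∈ ℓ¹(ℤ) be invertible in the convolution Banach algebra ℓ¹(ℤ), and for n ∈ ℤ let μ^{*n} denote its n-th convolution power (with μ^{*0} = δ and μ^{*(−n)} = (μ^{-1})^{*n}). Then there is a constant K with ‖μ^{*n}‖_{ℓ¹} ≤ K for all n ∈ ℤ if and only if there exist an integer p and a complex number w with |w| = 1 such that μ(p) = w and μ(m) = 0 for all m ≠ p. -/

import Mathlib

open Filter

open MeasureTheory AddCircle Topology

section Wiener

variable {a b : ℤ → ℂ}

lemma norm_mul_fourier (z : ℂ) (k : ℤ) (t : UnitAddCircle) : ‖z * fourier k t‖ = ‖z‖ := by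
  rw [norm_mul, fourier_apply, Circle.norm_coe, mul_one]

lemma summable_mul_fourier (ha : Summable fun k => ‖a k‖) (t : UnitAddCircle) :
    Summable fun k => a k * fourier k t :=
  .of_norm (by simpa only [norm_mul_fourier] using ha)

lemma norm_tsum_mul_fourier_le (ha : Summable fun k => ‖a k‖) (t : UnitAddCircle) :
    ‖∑' k, a k * fourier k t‖ ≤ ∑' k, ‖a k‖ := by
  have h := norm_tsum_le_tsum_norm (f := fun k => a k * fourier k t)
    (by simpa only [norm_mul_fourier] using ha)
  simpa only [norm_mul_fourier] using h

lemma continuous_tsum_mul_fourier (ha : Summable fun k => ‖a k‖) :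
    Continuous fun t : UnitAddCircle => ∑' k, a k * fourier k t :=
  continuous_tsum (fun _ => continuous_const.mul (map_continuous _)) ha
    fun _ _ => (norm_mul_fourier _ _ _).le

/-- A Fourier series with absolutely summable coefficients has these Fourier coefficients. -/
lemma fourierCoeff_tsum_mul_fourier (ha : Summable fun k => ‖a k‖) (n : ℤ) :
    fourierCoeff (fun t : UnitAddCircle => ∑' k, a k * fourier k t) n = a n := by
  have key (k : ℤ) : ∫ t : UnitAddCircle, fourier (-n) t * (a k * fourier k t) ∂haarAddCircle
      = if k = n then a k else 0 := by
    have h := congrFun (fourierCoeff_fourier (T := 1) k) n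
    simp only [fourierCoeff, smul_eq_mul] at h
    simp_rw [mul_left_comm _ (a k)]
    rw [integral_const_mul, h]
    by_cases hk : k = n
    · subst hk; simp
    · simp [hk, Ne.symm hk]
  have hs := hasSum_integral_of_summable_integral_norm (μ := haarAddCircle)
    (F := fun (k : ℤ) (t : UnitAddCircle) => fourier (-n) t * (a k * fourier k t))
    (fun k => Continuous.integrable_of_hasCompactSupport (by fun_prop)
      (HasCompactSupport.of_compactSpace _)) (by
        simpa [norm_mul_fourier, Circle.norm_coe] using ha)
  simp only [key, tsum_mul_left] at hs
  rw [fourierCoeff]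
  simp only [smul_eq_mul]
  rw [← hs.tsum_eq, tsum_ite_eq]

/-- The change of variables `(j, k) ↦ (k, j - k)` underlying the convolution on `ℤ`. -/
def convolutionEquiv : ℤ × ℤ ≃ ℤ × ℤ where
  toFun p := (p.2, p.1 - p.2)
  invFun q := (q.1 + q.2, q.1)
  left_inv p := by simp
  right_inv q := by simp

lemma summable_mul_sub (ha : Summable fun k => ‖a k‖) (hb : Summable fun k => ‖b k‖) :
    Summable fun p : ℤ × ℤ => ‖a p.2 * b (p.1 - p.2)‖ := by
  exact (convolutionEquiv.summable_iff (f := fun q : ℤ × ℤ => ‖a q.1 * b q.2‖)).2 (ha.mul_norm hb)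

lemma tsum_mul_tsum_eq_tsum_convolution (ha : Summable fun k => ‖a k‖)
    (hb : Summable fun k => ‖b k‖) :
    (∑' k, a k) * ∑' k, b k = ∑' j, ∑' k, a k * b (j - k) := by
  rw [tsum_mul_tsum_of_summable_norm ha hb, ← convolutionEquiv.tsum_eq]
  exact (summable_mul_sub ha hb).of_norm.tsum_prod

lemma summable_norm_convolution (ha : Summable fun k => ‖a k‖) (hb : Summable fun k => ‖b k‖) :
    Summable fun j => ‖∑' k, a k * b (j - k)‖ :=
  (summable_mul_sub ha hb).prod.of_nonneg_of_le (fun _ => norm_nonneg _)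
    fun j => norm_tsum_le_tsum_norm ((summable_mul_sub ha hb).prod_factor j)

lemma tsum_norm_convolution_le (ha : Summable fun k => ‖a k‖) (hb : Summable fun k => ‖b k‖) :
    ∑' j, ‖∑' k, a k * b (j - k)‖ ≤ (∑' k, ‖a k‖) * ∑' k, ‖b k‖ := by
  have h : (∑' k, ‖a k‖) * ∑' k, ‖b k‖ = ∑' j, ∑' k, ‖a k * b (j - k)‖ := by
    rw [ha.tsum_mul_tsum hb (by simpa using ha.mul_norm hb), ← convolutionEquiv.tsum_eq]
    rw [← (summable_mul_sub ha hb).tsum_prod]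
    exact tsum_congr fun p => (norm_mul _ _).symm
  rw [h]
  exact (summable_norm_convolution ha hb).tsum_le_tsum
    (fun j => norm_tsum_le_tsum_norm ((summable_mul_sub ha hb).prod_factor j))
    (summable_mul_sub ha hb).prod

/-- The Fourier series of a convolution is the product of the Fourier series. -/
lemma tsum_mul_fourier_mul (ha : Summable fun k => ‖a k‖) (hb : Summable fun k => ‖b k‖)
    (t : UnitAddCircle) :
    (∑' k, a k * fourier k t) * ∑' k, b k * fourier k t
      = ∑' j, (∑' k, a k * b (j - k)) * fourier j t := by
  rw [tsum_mul_tsum_eq_tsum_convolution (by simpa only [norm_mul_fourier] using ha)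
    (by simpa only [norm_mul_fourier] using hb)]
  refine tsum_congr fun j => ?_
  rw [← tsum_mul_right]
  refine tsum_congr fun k => ?_
  rw [show fourier j t = fourier k t * fourier (j - k) t by rw [← fourier_add]; simp]
  ring

/-- `f` is the sum of a Fourier series whose coefficients have `ℓ¹` norm at most `K`. -/
def WienerBound (f : UnitAddCircle → ℂ) (K : ℝ) : Prop :=
  ∃ a : ℤ → ℂ, (Summable fun k => ‖a k‖) ∧ ∑' k, ‖a k‖ ≤ K ∧ ∀ t, f t = ∑' k, a k * fourier k t

variable {f g : UnitAddCircle → ℂ} {K L : ℝ}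

lemma WienerBound.continuous (hf : WienerBound f K) : Continuous f := by
  obtain ⟨a, ha, -, h⟩ := hf
  rw [funext h]
  exact continuous_tsum_mul_fourier ha

lemma WienerBound.norm_le (hf : WienerBound f K) (t : UnitAddCircle) : ‖f t‖ ≤ K := by
  obtain ⟨a, ha, haK, h⟩ := hf
  rw [h]
  exact (norm_tsum_mul_fourier_le ha t).trans haK

lemma WienerBound.mul (hf : WienerBound f K) (hg : WienerBound g L) :
    WienerBound (fun t => f t * g t) (K * L) := by
  obtain ⟨a, ha, haK, hfa⟩ := hf
  obtain ⟨b, hb, hbL, hgb⟩ := hg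
  refine ⟨_, summable_norm_convolution ha hb, (tsum_norm_convolution_le ha hb).trans ?_,
    fun t => by simp only [hfa, hgb, tsum_mul_fourier_mul ha hb]⟩
  exact mul_le_mul haK hbL (tsum_nonneg fun _ => norm_nonneg _)
    ((tsum_nonneg fun _ => norm_nonneg _).trans haK)

lemma WienerBound.comp_add_right (hf : WienerBound f K) (u : UnitAddCircle) :
    WienerBound (fun t => f (t + u)) K := by
  obtain ⟨a, ha, haK, hfa⟩ := hf
  refine ⟨fun k => a k * fourier k u, by simpa only [norm_mul_fourier] using ha,
    by simpa only [norm_mul_fourier] using haK, fun t => ?_⟩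
  simp only [hfa]
  refine tsum_congr fun k => ?_
  simp only [fourier_apply, smul_add, toCircle_add, Circle.coe_mul]
  ring

lemma WienerBound.const_mul (hf : WienerBound f K) {c : ℂ} (hc : ‖c‖ = 1) :
    WienerBound (fun t => c * f t) K := by
  obtain ⟨a, ha, haK, hfa⟩ := hf
  refine ⟨fun k => c * a k, by simpa [hc] using ha, by simpa [hc] using haK, fun t => ?_⟩
  simp only [hfa, ← tsum_mul_left]
  exact tsum_congr fun k => (mul_assoc _ _ _).symm

lemma wienerBound_fourier (m : ℤ) : WienerBound (fourier m) 1 := by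
  refine ⟨Pi.single m 1, ?_, ?_, fun t => ?_⟩
  · exact summable_of_ne_finset_zero (s := {m}) fun k hk => by
      simp [Finset.notMem_singleton.1 hk]
  · rw [tsum_eq_single m fun k hk => by simp [hk]]
    simp
  · rw [tsum_eq_single m fun k hk => by simp [hk]]
    simp

lemma WienerBound.sum_norm_fourierCoeff_le (hf : WienerBound f K) (s : Finset ℤ) :
    ∑ k ∈ s, ‖fourierCoeff f k‖ ≤ K := by
  obtain ⟨a, ha, haK, h⟩ := hf
  rw [funext h]
  simp only [fourierCoeff_tsum_mul_fourier ha]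
  exact (ha.sum_le_tsum _ fun _ _ => norm_nonneg _).trans haK

end Wiener

lemma tendsto_cesaro_pow {z : ℂ} (hz : ‖z‖ = 1) :
    Tendsto (fun N : ℕ => (N : ℂ)⁻¹ * ∑ n ∈ Finset.range N, z ^ n) atTop
      (𝓝 (if z = 1 then 1 else 0)) := by
  split_ifs with h
  · subst h
    refine tendsto_const_nhds.congr' ?_
    filter_upwards [eventually_ne_atTop 0] with N hN
    simp [hN]
  · refine squeeze_zero_norm (a := fun N : ℕ => (N : ℝ)⁻¹ * (2 / ‖z - 1‖)) (fun N => ?_) ?_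
    · rw [geom_sum_eq h, norm_mul, norm_inv, Complex.norm_natCast, norm_div]
      gcongr
      refine (norm_sub_le _ _).trans ?_
      simp [hz]
      norm_num
    · simpa using (tendsto_inv_atTop_nhds_zero_nat (𝕜 := ℝ)).mul_const (2 / ‖z - 1‖)

lemma norm_cesaro_pow_le {z : ℂ} (hz : ‖z‖ = 1) (N : ℕ) :
    ‖(N : ℂ)⁻¹ * ∑ n ∈ Finset.range N, z ^ n‖ ≤ 1 := by
  rw [norm_mul, norm_inv, Complex.norm_natCast]
  have h : ‖∑ n ∈ Finset.range N, z ^ n‖ ≤ N := by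
    refine (norm_sum_le _ _).trans ?_
    simp [hz]
  exact inv_mul_le_one_of_le₀ h (Nat.cast_nonneg _)

lemma integrable_of_continuous_circle {f : UnitAddCircle → ℂ} (hf : Continuous f) :
    Integrable f haarAddCircle :=
  hf.integrable_of_hasCompactSupport (HasCompactSupport.of_compactSpace _)

/-- A square-integrable function with absolutely summable Fourier coefficients agrees almost
everywhere with a continuous function. -/
lemma exists_continuous_ae_eq_of_summable_fourierCoeff {f : UnitAddCircle → ℂ}
    (hf : MemLp f 2 haarAddCircle) (hs : Summable (fourierCoeff f)) :
    ∃ g : C(UnitAddCircle, ℂ), f =ᵐ[haarAddCircle] g := by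
  have h1 := hasSum_fourier_series_L2 hf.toLp
  rw [fourierCoeff_congr_ae hf.coeFn_toLp] at h1
  have h2 : Summable fun n => fourierCoeff f n • (fourier n : C(UnitAddCircle, ℂ)) :=
    .of_norm (by simpa [norm_smul, fourier_norm] using hs.norm)
  have h3 := (ContinuousMap.toLp (E := ℂ) 2 (haarAddCircle (T := 1)) ℂ).hasSum h2.hasSum
  simp only [map_smul] at h3
  refine ⟨∑' n, fourierCoeff f n • fourier n, ?_⟩
  have h4 := h1.unique h3
  have h5 := ContinuousMap.coeFn_toLp (p := 2) (𝕜 := ℂ) (haarAddCircle (T := 1))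
    (∑' n, fourierCoeff f n • fourier n)
  rw [← h4] at h5
  exact hf.coeFn_toLp.symm.trans h5

/-- If the powers of a unimodular function have bounded Wiener norm, its level sets are null or
everything. -/
lemma measure_level_eq_zero_or_forall_eq {f : UnitAddCircle → ℂ} {K : ℝ}
    (hf : ∀ n : ℕ, WienerBound (fun t => f t ^ n) K) (hnorm : ∀ t, ‖f t‖ = 1) (c : ℂ) :
    haarAddCircle {t | f t = c} = 0 ∨ ∀ t, f t = c := by
  have hcont : Continuous f := by simpa using (hf 1).continuous
  by_cases hc : ‖c‖ = 1
  swap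
  · left
    convert measure_empty (μ := haarAddCircle (T := 1))
    ext t
    simp only [Set.mem_ofPred_eq, Set.mem_empty_iff_false, iff_false]
    rintro rfl
    exact hc (hnorm t)
  have hc0 : c ≠ 0 := by rintro rfl; simp at hc
  set g : UnitAddCircle → ℂ := fun t => c⁻¹ * f t with hg
  have hg1 (t : UnitAddCircle) : ‖g t‖ = 1 := by simp [hg, hc, hnorm]
  have hgc : Continuous g := by fun_prop
  have hgn (n : ℕ) : WienerBound (fun t => g t ^ n) K := by
    simp only [hg, mul_pow]
    exact (hf n).const_mul (by simp [hc])
  have hgE (t : UnitAddCircle) : g t = 1 ↔ f t = c := by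
    rw [hg]
    simp only
    rw [inv_mul_eq_one₀ hc0, eq_comm]
  set χ : UnitAddCircle → ℂ := fun t => if g t = 1 then 1 else 0 with hχ
  have hE : MeasurableSet {t | g t = 1} := (isClosed_eq hgc continuous_const).measurableSet
  have hχm : Measurable χ := Measurable.ite hE measurable_const measurable_const
  have hlim (k : ℤ) : Tendsto (fun N : ℕ => (N : ℂ)⁻¹ *
      ∑ n ∈ Finset.range N, fourierCoeff (fun t => g t ^ n) k) atTop (𝓝 (fourierCoeff χ k)) := by
    have h := tendsto_integral_of_dominated_convergence (μ := haarAddCircle (T := 1))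
      (F := fun (N : ℕ) t => fourier (-k) t * ((N : ℂ)⁻¹ * ∑ n ∈ Finset.range N, g t ^ n))
      (f := fun t => fourier (-k) t * χ t) (fun _ => 1)
      (fun N => Continuous.aestronglyMeasurable (by fun_prop)) (integrable_const _)
      (fun N => .of_forall fun t => by
        rw [norm_mul, fourier_apply, Circle.norm_coe, one_mul]
        exact norm_cesaro_pow_le (hg1 t) N)
      (.of_forall fun t => (tendsto_cesaro_pow (hg1 t)).const_mul _)
    refine h.congr fun N => ?_
    simp only [fourierCoeff, smul_eq_mul]
    rw [← integral_finsetSum _ fun n _ => integrable_of_continuous_circle (by fun_prop),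
      ← integral_const_mul]
    refine integral_congr_ae (.of_forall fun t => ?_)
    simp only [Finset.mul_sum]
    exact Finset.sum_congr rfl fun n _ => by ring
  have hbound (s : Finset ℤ) : ∑ k ∈ s, ‖fourierCoeff χ k‖ ≤ K := by
    refine le_of_tendsto (tendsto_finsetSum s fun k _ => (hlim k).norm)
      (eventually_gt_atTop 0 |>.mono fun N hN => ?_)
    have hN' : (0 : ℝ) < N := by exact_mod_cast hN
    calc ∑ k ∈ s, ‖(N : ℂ)⁻¹ * ∑ n ∈ Finset.range N, fourierCoeff (fun t => g t ^ n) k‖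
        ≤ ∑ k ∈ s, (N : ℝ)⁻¹ * ∑ n ∈ Finset.range N, ‖fourierCoeff (fun t => g t ^ n) k‖ := by
          gcongr with k
          rw [norm_mul, norm_inv, Complex.norm_natCast]
          gcongr
          exact norm_sum_le _ _
      _ = (N : ℝ)⁻¹ * ∑ n ∈ Finset.range N, ∑ k ∈ s, ‖fourierCoeff (fun t => g t ^ n) k‖ := by
          rw [← Finset.mul_sum, Finset.sum_comm]
      _ ≤ (N : ℝ)⁻¹ * ∑ n ∈ Finset.range N, K := by
          gcongr with n
          exact (hgn n).sum_norm_fourierCoeff_le s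
      _ = K := by simp [hN'.ne']
  have hsum : Summable (fourierCoeff χ) :=
    .of_norm (summable_of_sum_le (fun _ => norm_nonneg _) hbound)
  obtain ⟨h, hh⟩ := exists_continuous_ae_eq_of_summable_fourierCoeff
    (MemLp.of_bound hχm.aestronglyMeasurable 1
      (.of_forall fun t => by simp only [hχ]; split_ifs <;> simp)) hsum
  have hidem : (fun t => h t * h t) = h :=
    Measure.eq_of_ae_eq (μ := haarAddCircle) (by
      filter_upwards [hh] with t ht
      rw [← ht]
      simp [hχ]) (by fun_prop) (by fun_prop)
  have h01 (t : UnitAddCircle) : h t ∈ ({0, 1} : Set ℂ) := by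
    have := congrFun hidem t
    by_cases h0 : h t = 0
    · simp [h0]
    · right
      exact mul_left_cancel₀ h0 (by simpa using this)
  obtain ⟨y, hy, hy'⟩ := isPreconnected_univ.eqOn_const_of_mapsTo
    (T := ({0, 1} : Set ℂ)) (Set.toFinite _).isDiscrete h.continuous.continuousOn (fun t _ => h01 t) ⟨0, by simp⟩
  rcases hy with rfl | rfl
  · left
    rw [← compl_compl {t | f t = c}]
    rw [← mem_ae_iff]
    filter_upwards [hh] with t ht
    rw [hy' (Set.mem_univ t)] at ht
    rw [Set.mem_compl_iff, Set.mem_ofPred_eq, ← hgE]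
    intro h1
    simp [hχ, h1] at ht
  · right
    have : g = fun _ => 1 := Measure.eq_of_ae_eq (μ := haarAddCircle) (by
      filter_upwards [hh] with t ht
      rw [hy' (Set.mem_univ t)] at ht
      by_contra h1
      simp [hχ, h1] at ht) hgc continuous_const
    intro t
    rw [← hgE, this]

lemma tendsto_cesaro_norm_integral_pow_sq {f : UnitAddCircle → ℂ} (hcont : Continuous f)
    (hnorm : ∀ t, ‖f t‖ = 1) (hnull : ∀ c, haarAddCircle {t | f t = c} = 0) :
    Tendsto (fun N : ℕ => (N : ℝ)⁻¹ *
      ∑ n ∈ Finset.range N, ‖∫ t, f t ^ n ∂haarAddCircle‖ ^ 2) atTop (𝓝 0) := by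
  have hmul (s t : UnitAddCircle) : ‖f s * (starRingEnd ℂ) (f t)‖ = 1 := by simp [hnorm]
  have hinner (t : UnitAddCircle) (N : ℕ) :
      ∫ s, (N : ℂ)⁻¹ * ∑ n ∈ Finset.range N, (f s * (starRingEnd ℂ) (f t)) ^ n ∂haarAddCircle =
      (N : ℂ)⁻¹ * ∑ n ∈ Finset.range N,
        (∫ s, f s ^ n ∂haarAddCircle) * (starRingEnd ℂ) (f t) ^ n := by
    rw [integral_const_mul, integral_finsetSum _ fun n _ =>
      integrable_of_continuous_circle (by fun_prop)]
    simp only [mul_pow, integral_mul_const]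
  have hone (t : UnitAddCircle) : Tendsto (fun N : ℕ => (N : ℂ)⁻¹ * ∑ n ∈ Finset.range N,
        (∫ s, f s ^ n ∂haarAddCircle) * (starRingEnd ℂ) (f t) ^ n) atTop (𝓝 0) := by
    have h := tendsto_integral_of_dominated_convergence (μ := haarAddCircle (T := 1))
      (F := fun (N : ℕ) s =>
        (N : ℂ)⁻¹ * ∑ n ∈ Finset.range N, (f s * (starRingEnd ℂ) (f t)) ^ n)
      (f := fun _ => 0) (fun _ => 1)
      (fun N => Continuous.aestronglyMeasurable (by fun_prop)) (integrable_const _)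
      (fun N => .of_forall fun s => norm_cesaro_pow_le (hmul s t) N) (by
        filter_upwards [measure_eq_zero_iff_ae_notMem.1 (hnull (f t))] with s hs
        have h1 := tendsto_cesaro_pow (hmul s t)
        rwa [if_neg] at h1
        intro h2
        apply hs
        have h3 : (starRingEnd ℂ) (f t) * f t = 1 := by
          rw [mul_comm, Complex.mul_conj, Complex.normSq_eq_norm_sq, hnorm]; simp
        calc f s = f s * ((starRingEnd ℂ) (f t) * f t) := by rw [h3, mul_one]
          _ = f t := by rw [← mul_assoc, h2, one_mul])
    simpa only [hinner, integral_zero] using h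
  have h := tendsto_integral_of_dominated_convergence (μ := haarAddCircle (T := 1))
    (F := fun (N : ℕ) t => (N : ℂ)⁻¹ * ∑ n ∈ Finset.range N,
        (∫ s, f s ^ n ∂haarAddCircle) * (starRingEnd ℂ) (f t) ^ n)
    (f := fun _ => 0) (fun _ => 1)
    (fun N => Continuous.aestronglyMeasurable (by fun_prop)) (integrable_const _)
    (fun N => .of_forall fun t => by
      rw [← hinner]
      simpa using norm_integral_le_of_norm_le_const (μ := haarAddCircle (T := 1)) (C := 1)
        (.of_forall fun s => norm_cesaro_pow_le (hmul s t) N)) (.of_forall hone)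
  rw [integral_zero] at h
  have h' := (Complex.continuous_re.tendsto 0).comp h
  rw [Complex.zero_re] at h'
  refine h'.congr fun N => ?_
  simp only [Function.comp]
  rw [integral_const_mul, integral_finsetSum _ fun n _ =>
      integrable_of_continuous_circle (by fun_prop)]
  simp only [integral_const_mul, ← map_pow, integral_conj, Complex.mul_conj,
    Complex.normSq_eq_norm_sq]
  norm_cast
  rw [← Complex.ofReal_natCast, ← Complex.ofReal_inv, Complex.re_ofReal_mul, Complex.ofReal_re]

lemma continuous_integral_mul_conj {g : UnitAddCircle → ℂ} (hg : Continuous g) :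
    Continuous fun u => ∫ s, g (s + u) * (starRingEnd ℂ) (g s) ∂haarAddCircle := by
  have h := continuous_parametric_integral_of_continuous (μ := haarAddCircle (T := 1))
    (f := fun u s => g (s + u) * (starRingEnd ℂ) (g s))
    (by fun_prop) (isCompact_univ)
  simpa using h

/-- Fourier coefficients are controlled by the autocorrelation. -/
lemma norm_fourierCoeff_sq_le {g : UnitAddCircle → ℂ} (hg : Continuous g) (k : ℤ) :
    ‖fourierCoeff g k‖ ^ 2 ≤
      ∫ u, ‖∫ s, g (s + u) * (starRingEnd ℂ) (g s) ∂haarAddCircle‖ ∂haarAddCircle := by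
  have key : ∫ u, fourier (-k) u * ∫ s, g (s + u) * (starRingEnd ℂ) (g s) ∂haarAddCircle
      ∂haarAddCircle = fourierCoeff g k * (starRingEnd ℂ) (fourierCoeff g k) := by
    simp only [← integral_const_mul]
    rw [integral_integral_swap (Continuous.integrable_of_hasCompactSupport (by fun_prop)
      (HasCompactSupport.of_compactSpace _))]
    have h (s : UnitAddCircle) : ∫ u, fourier (-k) u * (g (s + u) * (starRingEnd ℂ) (g s))
        ∂haarAddCircle = fourierCoeff g k * (starRingEnd ℂ) (fourier (-k) s * g s) := by
      have h1 := integral_add_left_eq_self (μ := haarAddCircle (T := 1))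
        (fun u => fourier (-k) u * g u) s
      simp only [fourierCoeff, smul_eq_mul]
      rw [← h1, ← integral_mul_const]
      refine integral_congr_ae (.of_forall fun u => ?_)
      have h2 : (fourier (-k) s : ℂ) * (starRingEnd ℂ) (fourier (-k) s) = 1 := by
        rw [Complex.mul_conj, Complex.normSq_eq_norm_sq, fourier_apply, Circle.norm_coe]; simp
      have h3 : (fourier (-k) (s + u) : ℂ) = fourier (-k) s * fourier (-k) u := by
        simp only [fourier_apply, smul_add, toCircle_add, Circle.coe_mul]
      simp only [h3, map_mul]
      linear_combination (-(fourier (-k) u * g (s + u) * (starRingEnd ℂ) (g s))) * h2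
    simp only [h, integral_const_mul, integral_conj]
    simp only [fourierCoeff, smul_eq_mul]
  calc ‖fourierCoeff g k‖ ^ 2
      = ‖fourierCoeff g k * (starRingEnd ℂ) (fourierCoeff g k)‖ := by simp [sq]
    _ ≤ _ := by
      rw [← key]
      refine (norm_integral_le_integral_norm _).trans_eq ?_
      refine integral_congr_ae (.of_forall fun u => ?_)
      simp [Circle.norm_coe]

lemma sq_integral_le_integral_sq {φ : UnitAddCircle → ℝ} (hφ : Continuous φ) :
    (∫ u, φ u ∂haarAddCircle) ^ 2 ≤ ∫ u, φ u ^ 2 ∂haarAddCircle := by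
  have hint {ψ : UnitAddCircle → ℝ} (hψ : Continuous ψ) : Integrable ψ haarAddCircle :=
    hψ.integrable_of_hasCompactSupport (HasCompactSupport.of_compactSpace _)
  set m := ∫ u, φ u ∂haarAddCircle with hm
  have h : ∫ u, (2 * m * φ u - m ^ 2) ∂haarAddCircle ≤ ∫ u, φ u ^ 2 ∂haarAddCircle :=
    integral_mono (hint (by fun_prop)) (hint (by fun_prop)) fun u => by
      nlinarith [sq_nonneg (φ u - m)]
  rw [integral_sub (hint (by fun_prop)) (hint (by fun_prop)), integral_const_mul, ← hm] at h
  simp at h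
  linarith

lemma hasSum_norm_fourierCoeff_sq {g : UnitAddCircle → ℂ} (hg : Continuous g)
    (hnorm : ∀ t, ‖g t‖ = 1) : HasSum (fun k => ‖fourierCoeff g k‖ ^ 2) 1 := by
  have hmem : MemLp g 2 (haarAddCircle (T := 1)) :=
    MemLp.of_bound hg.aestronglyMeasurable 1 (.of_forall fun t => (hnorm t).le)
  have h := hasSum_sq_fourierCoeff hmem.toLp
  rw [fourierCoeff_congr_ae hmem.coeFn_toLp] at h
  convert h
  rw [integral_congr_ae (g := fun _ => (1 : ℝ))]
  · simp
  · filter_upwards [hmem.coeFn_toLp] with t ht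
    simp [ht, hnorm]

lemma WienerBound.exists_lt_norm_fourierCoeff {g : UnitAddCircle → ℂ} {K : ℝ}
    (hg : WienerBound g K) (hnorm : ∀ t, ‖g t‖ = 1) :
    ∃ k, (2 * K)⁻¹ < ‖fourierCoeff g k‖ := by
  by_contra! hle
  have hK : 1 ≤ K := by simpa [hnorm] using hg.norm_le 0
  have h1 := hasSum_norm_fourierCoeff_sq hg.continuous hnorm
  have h2 : (1 : ℝ) ≤ (2 * K)⁻¹ * K := by
    refine hasSum_le_of_sum_le h1 fun s => ?_
    calc ∑ k ∈ s, ‖fourierCoeff g k‖ ^ 2 ≤ ∑ k ∈ s, (2 * K)⁻¹ * ‖fourierCoeff g k‖ := by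
          gcongr with k
          rw [sq]
          gcongr
          exact hle k
      _ = (2 * K)⁻¹ * ∑ k ∈ s, ‖fourierCoeff g k‖ := by rw [Finset.mul_sum]
      _ ≤ (2 * K)⁻¹ * K := by
          gcongr
          exact hg.sum_norm_fourierCoeff_le s
  rw [mul_inv, mul_assoc, inv_mul_cancel₀ (by positivity)] at h2
  norm_num at h2

lemma ae_forall_fourier_ne_one :
    ∀ᵐ u : UnitAddCircle ∂haarAddCircle, ∀ m : ℤ, m ≠ 0 → (fourier m u : ℂ) ≠ 1 := by
  refine ae_all_iff.2 fun m => ?_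
  by_cases hm : m = 0
  · simp [hm]
  have hpow (n : ℕ) : WienerBound (fun t => fourier m t ^ n) 1 := by
    convert wienerBound_fourier (n * m) using 2 with t
    simp only [fourier_apply, mul_smul, natCast_zsmul, toCircle_nsmul, Circle.coe_pow]
  rcases measure_level_eq_zero_or_forall_eq hpow
    (fun t => by rw [fourier_apply, Circle.norm_coe]) 1 with h | h
  · filter_upwards [measure_eq_zero_iff_ae_notMem.1 h] with u hu _ using hu
  · exfalso
    have h0 : (fourier m : C(UnitAddCircle, ℂ)) = fourier 0 := by
      ext t; rw [h, fourier_zero]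
    have h1 := congrFun (fourierCoeff_fourier (T := 1) m) m
    rw [h0, fourierCoeff_fourier] at h1
    simp [hm] at h1

/-- A unimodular function on the circle whose integer powers have bounded Wiener norm is an
eigenvector of the translation by some element of infinite order. -/
theorem exists_translation_eigenvector {f : UnitAddCircle → ℂ} {K : ℝ}
    (hf : ∀ n : ℤ, WienerBound (fun t => f t ^ n) K) (hnorm : ∀ t, ‖f t‖ = 1) :
    ∃ (u : UnitAddCircle) (c : ℂ), (∀ m : ℤ, m ≠ 0 → (fourier m u : ℂ) ≠ 1) ∧
      ∀ s, f (s + u) = c * f s := by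
  by_contra! hno
  have hcont : Continuous f := by simpa using (hf 1).continuous
  have hK : 1 ≤ K := by simpa using (hf 0).norm_le 0
  have hconj (s : UnitAddCircle) : (starRingEnd ℂ) (f s) = (f s)⁻¹ :=
    (Complex.inv_eq_conj (hnorm s)).symm
  set A : ℕ → UnitAddCircle → ℂ := fun n u =>
    ∫ s, f (s + u) ^ n * (starRingEnd ℂ) (f s ^ n) ∂haarAddCircle with hA
  have hAc (n : ℕ) : Continuous (A n) := continuous_integral_mul_conj (hcont.pow n)
  have hA1 (n : ℕ) (u : UnitAddCircle) : ‖A n u‖ ≤ 1 := by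
    simpa [hA] using norm_integral_le_of_norm_le_const (μ := haarAddCircle (T := 1)) (C := 1)
      (f := fun s => f (s + u) ^ n * (starRingEnd ℂ) (f s ^ n))
      (.of_forall fun s => by simp [hnorm])
  have hlow (n : ℕ) : (2 * K)⁻¹ ^ 4 ≤ ∫ u, ‖A n u‖ ^ 2 ∂haarAddCircle := by
    have hW : WienerBound (fun t => f t ^ n) K := by simpa using hf n
    obtain ⟨k, hk⟩ := hW.exists_lt_norm_fourierCoeff (by simp [hnorm])
    calc (2 * K)⁻¹ ^ 4 = ((2 * K)⁻¹ ^ 2) ^ 2 := by ring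
      _ ≤ (‖fourierCoeff (fun t => f t ^ n) k‖ ^ 2) ^ 2 := by gcongr
      _ ≤ (∫ u, ‖A n u‖ ∂haarAddCircle) ^ 2 := by
          gcongr
          exact norm_fourierCoeff_sq_le (hcont.pow n) k
      _ ≤ _ := sq_integral_le_integral_sq (hAc n).norm
  have hint (n : ℕ) : Integrable (fun u => ‖A n u‖ ^ 2) haarAddCircle :=
    Continuous.integrable_of_hasCompactSupport ((hAc n).norm.pow 2)
      (HasCompactSupport.of_compactSpace _)
  have hlim := tendsto_integral_of_dominated_convergence (μ := haarAddCircle (T := 1))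
    (F := fun (N : ℕ) u => (N : ℝ)⁻¹ * ∑ n ∈ Finset.range N, ‖A n u‖ ^ 2)
    (f := fun _ => 0) (fun _ => 1)
    (fun N => ((integrable_finsetSum _ fun n _ => hint n).const_mul _).aestronglyMeasurable)
    (integrable_const _)
    (fun N => .of_forall fun u => by
      rw [Real.norm_of_nonneg (by positivity)]
      refine inv_mul_le_one_of_le₀ ?_ (Nat.cast_nonneg _)
      calc ∑ n ∈ Finset.range N, ‖A n u‖ ^ 2 ≤ ∑ n ∈ Finset.range N, (1 : ℝ) := by
            gcongr with n
            exact pow_le_one₀ (norm_nonneg _) (hA1 n u)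
        _ = N := by simp)
    (by
      filter_upwards [ae_forall_fourier_ne_one] with u hu
      have hD (n : ℕ) : WienerBound (fun s => (f (s + u) * (f s)⁻¹) ^ n) (K * K) := by
        convert ((hf n).comp_add_right u).mul (hf (-n)) using 2 with s
        simp [mul_pow]
      have h := tendsto_cesaro_norm_integral_pow_sq (f := fun s => f (s + u) * (f s)⁻¹)
        (by simpa using (hD 1).continuous) (fun s => by simp [hnorm]) (fun c => by
          refine (measure_level_eq_zero_or_forall_eq hD (fun s => by simp [hnorm]) c).resolve_right
            fun hc => ?_
          obtain ⟨s, hs⟩ := hno u c hu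
          refine hs ?_
          rw [← hc s, inv_mul_cancel_right₀]
          rintro h0
          simpa [h0] using hnorm s)
      simpa [hA, mul_pow, hconj] using h)
  rw [integral_zero] at hlim
  have hge : (2 * K)⁻¹ ^ 4 ≤ (0 : ℝ) := by
    refine ge_of_tendsto hlim ((eventually_gt_atTop 0).mono fun N hN => ?_)
    have hN' : (0 : ℝ) < N := by exact_mod_cast hN
    rw [integral_const_mul, integral_finsetSum _ fun n _ => hint n, le_inv_mul_iff₀ hN']
    simpa using Finset.sum_le_sum fun n (_ : n ∈ Finset.range N) => hlow n
  have : 0 < (2 * K)⁻¹ ^ 4 := by positivity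
  linarith

lemma tsum_ite_mul_fourier (t : UnitAddCircle) :
    ∑' k : ℤ, (if k = 0 then (1 : ℂ) else 0) * fourier k t = 1 := by
  rw [tsum_eq_single 0 fun k hk => by simp [hk]]
  simp

/-- A family of powers of a point mass of modulus one consists of sequences of norm one. -/
lemma tsum_norm_powers_of_point_mass {μ : ℤ → ℂ} {P : ℤ → ℤ → ℂ} {p : ℤ}
    (hP0 : ∀ j : ℤ, P 0 j = if j = 0 then 1 else 0)
    (hPrec : ∀ n j : ℤ, P (n + 1) j = ∑' k : ℤ, μ k * P n (j - k))
    (hp : ‖μ p‖ = 1) (hm : ∀ m : ℤ, m ≠ p → μ m = 0) (n : ℤ) : ∑' j : ℤ, ‖P n j‖ = 1 := by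
  have hstep (n : ℤ) : ∑' j : ℤ, ‖P (n + 1) j‖ = ∑' j : ℤ, ‖P n j‖ := by
    rw [← (Equiv.subRight p).tsum_eq fun j => ‖P n j‖]
    refine tsum_congr fun j => ?_
    rw [hPrec, tsum_eq_single p fun k hk => by rw [hm k hk, zero_mul], norm_mul, hp, one_mul]
    rfl
  induction n with
  | zero =>
    rw [tsum_eq_single 0 fun k hk => by simp [hP0, hk]]
    simp [hP0]
  | succ n ih => rw [hstep, ih]
  | pred n ih =>
    rw [← hstep, sub_add_cancel, ih]

/-- The Fourier series of an invertible sequence has no zeros. -/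
lemma tsum_mul_fourier_ne_zero {μ ν : ℤ → ℂ}
    (hμ : Summable fun k => ‖μ k‖) (hν : Summable fun k => ‖ν k‖)
    (hinv : ∀ j : ℤ, ∑' k : ℤ, μ k * ν (j - k) = if j = 0 then 1 else 0) (t : UnitAddCircle) :
    ∑' k, μ k * fourier k t ≠ 0 := by
  have h := tsum_mul_fourier_mul hμ hν t
  simp only [hinv, tsum_ite_mul_fourier] at h
  exact left_ne_zero_of_mul_eq_one h

/-- The Fourier series of the convolution powers are the powers of the Fourier series. -/
lemma tsum_powers_mul_fourier {μ ν : ℤ → ℂ}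
    (hμ : Summable fun k => ‖μ k‖) (hν : Summable fun k => ‖ν k‖)
    (hinv : ∀ j : ℤ, ∑' k : ℤ, μ k * ν (j - k) = if j = 0 then 1 else 0)
    {P : ℤ → ℤ → ℂ}
    (hP0 : ∀ j : ℤ, P 0 j = if j = 0 then 1 else 0)
    (hPsummable : ∀ n : ℤ, Summable fun k => ‖P n k‖)
    (hPrec : ∀ n j : ℤ, P (n + 1) j = ∑' k : ℤ, μ k * P n (j - k))
    (n : ℤ) (t : UnitAddCircle) :
    ∑' k, P n k * fourier k t = (∑' k, μ k * fourier k t) ^ n := by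
  have hne := tsum_mul_fourier_ne_zero hμ hν hinv t
  have hstep (n : ℤ) : ∑' k, P (n + 1) k * fourier k t
      = (∑' k, μ k * fourier k t) * ∑' k, P n k * fourier k t := by
    rw [tsum_mul_fourier_mul hμ (hPsummable n)]
    simp only [hPrec]
  induction n with
  | zero => simp only [hP0, tsum_ite_mul_fourier, zpow_zero]
  | succ n ih => rw [hstep, ih, zpow_add_one₀ hne, mul_comm]
  | pred n ih =>
    apply mul_left_cancel₀ hne
    rw [← hstep, sub_add_cancel, ih, mul_comm, ← zpow_add_one₀ hne, sub_add_cancel]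

lemma eq_one_of_forall_zpow_le {x K : ℝ} (hx : 0 < x) (h : ∀ n : ℤ, x ^ n ≤ K) : x = 1 := by
  have key {y : ℝ} (hy : ∀ n : ℕ, y ^ n ≤ K) : y ≤ 1 := by
    by_contra! h1
    obtain ⟨n, hn⟩ := pow_unbounded_of_one_lt K h1
    exact (hy n).not_gt hn
  refine le_antisymm (key fun n => by simpa using h n) ?_
  rw [← inv_le_one₀ hx]
  exact key fun n => by simpa using h (-n)

/-- Beurling–Helson theorem for `ℓ¹(ℤ)` with convolution. Let `μ ∈ ℓ¹(ℤ)` be invertible,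
with inverse `ν` (so `μ * ν = δ`), and let `P : ℤ → ℓ¹(ℤ)` be the family of convolution
powers of `μ`, characterized by `P 0 = δ` and `P (n+1) = μ * P n` for all `n ∈ ℤ`
(invertibility makes this determine the negative powers as well). Then the powers are
uniformly bounded in `ℓ¹`-norm, `‖μ^{*n}‖₁ ≤ K` for all `n ∈ ℤ`, if and only if `μ` is a
unimodular multiple of a point mass: `μ(p) = w` with `|w| = 1` for some integer `p`, and
`μ(m) = 0` for all `m ≠ p`. -/
theorem beurling_helson (μ ν : ℤ → ℂ)
    (hμ : Summable fun k => ‖μ k‖) (hν : Summable fun k => ‖ν k‖)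
    (hinv : ∀ j : ℤ, ∑' k : ℤ, μ k * ν (j - k) = if j = 0 then 1 else 0)
    (P : ℤ → ℤ → ℂ)
    (hP0 : ∀ j : ℤ, P 0 j = if j = 0 then 1 else 0)
    (hPsummable : ∀ n : ℤ, Summable fun k => ‖P n k‖)
    (hPrec : ∀ n j : ℤ, P (n + 1) j = ∑' k : ℤ, μ k * P n (j - k)) :
    (∃ K : ℝ, ∀ n : ℤ, ∑' j : ℤ, ‖P n j‖ ≤ K) ↔
      (∃ (p : ℤ) (w : ℂ), ‖w‖ = 1 ∧ μ p = w ∧ ∀ m : ℤ, m ≠ p → μ m = 0) := by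
  refine ⟨fun ⟨K, hK⟩ => ?_, fun ⟨p, w, hw, hp, hm⟩ =>
    ⟨1, fun n => (tsum_norm_powers_of_point_mass hP0 hPrec (hp ▸ hw) hm n).le⟩⟩
  have hpow := tsum_powers_mul_fourier hμ hν hinv hP0 hPsummable hPrec
  set f : UnitAddCircle → ℂ := fun t => ∑' k, μ k * fourier k t with hf
  have hW (n : ℤ) : WienerBound (fun t => f t ^ n) K :=
    ⟨P n, hPsummable n, hK n, fun t => (hpow n t).symm⟩
  have hne (t : UnitAddCircle) : f t ≠ 0 := tsum_mul_fourier_ne_zero hμ hν hinv t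
  have hnorm (t : UnitAddCircle) : ‖f t‖ = 1 :=
    eq_one_of_forall_zpow_le (norm_pos_iff.2 (hne t)) fun n => by
      simpa using (hW n).norm_le t
  obtain ⟨u, c, hu, hc⟩ := exists_translation_eigenvector hW hnorm
  have hcoef (k : ℤ) : μ k * fourier k u = c * μ k := by
    rw [← fourierCoeff_tsum_mul_fourier (a := fun k => μ k * fourier k u)
        (by simpa only [norm_mul_fourier] using hμ) k,
      ← fourierCoeff_tsum_mul_fourier (a := fun k => c * μ k)
        (by simpa only [norm_mul] using hμ.mul_left ‖c‖) k]
    congr 1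
    funext t
    simp only [mul_assoc, tsum_mul_left]
    rw [← hc t]
    refine tsum_congr fun k => ?_
    simp only [fourier_apply, smul_add, toCircle_add, Circle.coe_mul]
    ring
  obtain ⟨p, hp⟩ : ∃ p, μ p ≠ 0 := by
    by_contra! h
    exact hne 0 (by simp [hf, h])
  have hval (k : ℤ) (hk : μ k ≠ 0) : (fourier k u : ℂ) = c :=
    mul_left_cancel₀ hk (by rw [hcoef, mul_comm])
  have hm (m : ℤ) (hmp : m ≠ p) : μ m = 0 := by
    by_contra h
    refine hu (m - p) (sub_ne_zero.2 hmp) ?_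
    rw [sub_eq_add_neg, fourier_add, fourier_neg, hval m h, ← hval p hp, Complex.mul_conj,
      Complex.normSq_eq_norm_sq, fourier_apply, Circle.norm_coe]
    simp
  refine ⟨p, μ p, ?_, rfl, hm⟩
  rw [← hnorm 0]
  simp only [hf]
  rw [tsum_eq_single p fun k hk => by rw [hm k hk, zero_mul], norm_mul_fourier]
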